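/- Let μ, ν′ be probability measures on ℝ and set ν = μ ⊞ ν′. Then the subordination distribution satisfies μ ⊳ ν = B[μ ⊳ ν′]; in particular μ ⊳ (μ ⊞ ν′) is ⊞-infinitely divisible. -/

import Mathlib

open MeasureTheory Complex

noncomputable section

/-- The Cauchy transform `G_μ(z) = ∫ 1/(z - x) dμ(x)` of a measure on `ℝ`. -/
def cauchyG (μ : Measure ℝ) (z : ℂ) : ℂ := ∫ x : ℝ, (z - (x : ℂ))⁻¹ ∂μ

/-- The F-transform `F_μ = 1/G_μ`. -/
def Ftr (μ : Measure ℝ) (z : ℂ) : ℂ := (cauchyG μ z)⁻¹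

/-- The open upper half-plane `ℂ⁺`. -/
def UHP : Set ℂ := {z : ℂ | 0 < z.im}

/-- The truncated cone `Γ_{α,M} = {z ∈ ℂ⁺ : |Re z| < α · Im z, Im z > M}`. -/
def tcone (α M : ℝ) : Set ℂ := {z : ℂ | |z.re| < α * z.im ∧ M < z.im}

/-- `φ` is a Voiculescu transform of `μ`: `φ(F_μ(z)) + F_μ(z) = z` on some truncated cone. -/
def IsVT (μ : Measure ℝ) (φ : ℂ → ℂ) : Prop :=
  ∃ α M : ℝ, 0 < α ∧ 0 < M ∧ ∀ z ∈ tcone α M, φ (Ftr μ z) + Ftr μ z = z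

/-- `ψ` is a two-state Voiculescu transform of the pair `(μt, μ)`:
`ψ(F_μ(z)) + F_{μt}(z) = z` on some truncated cone. -/
def IsTwoStateVT (μt μ : Measure ℝ) (ψ : ℂ → ℂ) : Prop :=
  ∃ α M : ℝ, 0 < α ∧ 0 < M ∧ ∀ z ∈ tcone α M, ψ (Ftr μ z) + Ftr μt z = z

/-- `μ` is freely infinitely divisible: some Voiculescu transform `φ` of `μ` is such that
`t·φ` is a Voiculescu transform of a probability measure for every `t ≥ 0`. -/
def IsFID (μ : Measure ℝ) : Prop :=
  ∃ φ : ℂ → ℂ, IsVT μ φ ∧ ∀ t : ℝ, 0 ≤ t →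
    ∃ ν : Measure ℝ, IsProbabilityMeasure ν ∧ IsVT ν (fun z => (t : ℂ) * φ z)

/-- The semicircular distribution with mean `β` and variance `γ` (Dirac mass at `β` for `γ = 0`). -/
def semicircle (β γ : ℝ) : Measure ℝ :=
  if γ = 0 then Measure.dirac β
  else volume.withDensity
    (fun x => ENNReal.ofReal ((2 * Real.pi * γ)⁻¹ * Real.sqrt (4 * γ - (x - β) ^ 2)))

lemma sub_ofReal_ne_zero {z : ℂ} (hz : 0 < z.im) (x : ℝ) : z - (x : ℂ) ≠ 0 := by
  intro h
  have := congrArg Complex.im h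
  simp at this
  exact hz.ne' this

/-- Diagonal matrix coefficients of the resolvent of a symmetric operator on a finite-dimensional
space are Cauchy transforms of finitely supported measures. -/
lemma exists_inner_resolvent_eq_sum {E : Type*} [NormedAddCommGroup E] [InnerProductSpace ℂ E]
    [FiniteDimensional ℂ E] {T : E →ₗ[ℂ] E} (hT : T.IsSymmetric) (u : E) :
    ∃ (n : ℕ) (c b : Fin n → ℝ), (∀ i, 0 ≤ c i) ∧ ∑ i, c i = ‖u‖ ^ 2 ∧
      ∀ z : ℂ, 0 < z.im → ∀ v : E, z • v - T v = u →
        inner ℂ u v = ∑ i, (c i : ℂ) * (z - (b i : ℂ))⁻¹ := by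
  let e := hT.eigenvectorBasis rfl
  let b := hT.eigenvalues rfl
  refine ⟨_, fun i => ‖inner ℂ (e i) u‖ ^ 2, b, fun i => by positivity,
    e.sum_sq_norm_inner_right u, fun z hz v hv => ?_⟩
  rw [← e.sum_inner_mul_inner u v]
  refine Finset.sum_congr rfl fun i _ => ?_
  have h1 : (z - (b i : ℂ)) * inner ℂ (e i) v = inner ℂ (e i) u := by
    rw [← hv, inner_sub_right, inner_smul_right, ← hT (e i) v, hT.apply_eigenvectorBasis rfl i,
      inner_smul_left]
    simp [e, b, sub_mul]
  have h2 : inner ℂ (e i) v = inner ℂ (e i) u * (z - (b i : ℂ))⁻¹ := by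
    rw [← h1]; field_simp [sub_ofReal_ne_zero hz (b i)]
  rw [h2, ← mul_assoc, ← inner_conj_symm u (e i), ← Complex.normSq_eq_conj_mul_self,
    Complex.normSq_eq_norm_sq]

/-- The function `z ↦ ∑ cᵢ / (z - bᵢ)`, the Cauchy transform of a finitely supported measure. -/
def discreteG {ι : Type*} [Fintype ι] (c b : ι → ℝ) (z : ℂ) : ℂ :=
  ∑ i, (c i : ℂ) * (z - (b i : ℂ))⁻¹

lemma discreteG_im_nonpos {ι : Type*} [Fintype ι] {c : ι → ℝ} (hc : ∀ i, 0 ≤ c i) (b : ι → ℝ)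
    {z : ℂ} (hz : 0 < z.im) : (discreteG c b z).im ≤ 0 := by
  rw [discreteG, Complex.im_sum]
  refine Finset.sum_nonpos fun i _ => ?_
  rw [Complex.im_ofReal_mul, Complex.inv_im]
  refine mul_nonpos_of_nonneg_of_nonpos (hc i) ?_
  refine div_nonpos_of_nonpos_of_nonneg ?_ (Complex.normSq_nonneg _)
  simpa using hz.le

lemma toEuclideanLin_apply_eq_sum {ι : Type*} [Fintype ι] [DecidableEq ι] (A : Matrix ι ι ℂ)
    (v : EuclideanSpace ℂ ι) (i : ι) : Matrix.toEuclideanLin A v i = ∑ j, A i j * v j := rfl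

/-- The reciprocal of `z - a - ∑ cᵢ / (z - bᵢ)` is the Cauchy transform of a finitely supported
probability measure. -/
lemma exists_inv_eq_discreteG {ι : Type*} [Fintype ι] {c : ι → ℝ} (hc : ∀ i, 0 ≤ c i)
    (b : ι → ℝ) (a : ℝ) :
    ∃ (n : ℕ) (p x : Fin n → ℝ), (∀ i, 0 ≤ p i) ∧ ∑ i, p i = 1 ∧
      ∀ z : ℂ, 0 < z.im → (z - a - discreteG c b z)⁻¹ = discreteG p x z := by
  classical
  let A : Matrix (Option ι) (Option ι) ℂ := Matrix.of fun i j =>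
    match i, j with
    | none, none => (a : ℂ)
    | none, some j => ((√(c j) : ℝ) : ℂ)
    | some i, none => ((√(c i) : ℝ) : ℂ)
    | some i, some j => if i = j then (b i : ℂ) else 0
  have hA : A.IsHermitian := by
    refine Matrix.IsHermitian.ext fun i j => ?_
    rcases i with _ | i <;> rcases j with _ | j <;> simp [A]
    by_cases h : j = i
    · subst h; simp
    · simp [h, Ne.symm h]
  have hT := Matrix.isSymmetric_toEuclideanLin_iff.mpr hA
  let u : EuclideanSpace ℂ (Option ι) := EuclideanSpace.single none 1
  obtain ⟨n, p, x, hp, hsum, h⟩ := exists_inner_resolvent_eq_sum hT u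
  refine ⟨n, p, x, hp, by simpa [u] using hsum, fun z hz => ?_⟩
  set f := z - a - discreteG c b z with hf
  have hf0 : f ≠ 0 := by
    intro h0
    have := congrArg Complex.im h0
    have h1 := discreteG_im_nonpos hc b hz
    simp [hf] at this
    linarith
  let v : EuclideanSpace ℂ (Option ι) := WithLp.toLp 2 fun i =>
    match i with
    | none => f⁻¹
    | some i => (√(c i) : ℝ) * (z - (b i : ℂ))⁻¹ * f⁻¹
  have hv0 : v none = f⁻¹ := rfl
  have hvs : ∀ i, v (some i) = (√(c i) : ℝ) * (z - (b i : ℂ))⁻¹ * f⁻¹ := fun i => rfl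
  have hv : z • v - Matrix.toEuclideanLin A v = u := by
    ext i
    rw [PiLp.sub_apply, PiLp.smul_apply, toEuclideanLin_apply_eq_sum, Fintype.sum_option]
    rcases i with _ | i
    · have h1 : ∑ i, ((√(c i) : ℝ) : ℂ) * ((√(c i) : ℝ) * (z - (b i : ℂ))⁻¹ * f⁻¹)
          = discreteG c b z * f⁻¹ := by
        rw [discreteG, Finset.sum_mul]
        refine Finset.sum_congr rfl fun i _ => ?_
        rw [← mul_assoc, ← mul_assoc, ← Complex.ofReal_mul, Real.mul_self_sqrt (hc i)]
      simp only [A, Matrix.of_apply, hv0, hvs, h1, u, PiLp.single_apply, if_true, smul_eq_mul]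
      have : z * f⁻¹ - (a * f⁻¹ + discreteG c b z * f⁻¹) = f * f⁻¹ := by rw [hf]; ring
      rw [this, mul_inv_cancel₀ hf0]
    · simp only [A, Matrix.of_apply, hv0, hvs, u, PiLp.single_apply, smul_eq_mul, ite_mul,
        zero_mul, Finset.sum_ite_eq, Finset.mem_univ, if_true, reduceCtorEq, if_false]
      have := sub_ofReal_ne_zero hz (b i)
      field_simp
      ring
  rw [discreteG, ← h z hz v hv, EuclideanSpace.inner_single_left, hv0]
  simp

/-- Schur complement formula for the compression of a resolvent to the line spanned by a unit
vector. -/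
lemma exists_inv_inner_resolvent_eq {E : Type*} [NormedAddCommGroup E] [InnerProductSpace ℂ E]
    [FiniteDimensional ℂ E] {X : E →ₗ[ℂ] E} (hX : X.IsSymmetric) {ξ : E} (hξ1 : ‖ξ‖ = 1) :
    ∃ (n : ℕ) (c b : Fin n → ℝ) (a : ℝ), (∀ i, 0 ≤ c i) ∧
      ∀ z : ℂ, 0 < z.im → ∀ y : E, z • y - X y = ξ → inner ℂ ξ y ≠ 0 →
        (inner ℂ ξ y)⁻¹ = z - a - discreteG c b z := by
  have hξ : inner ℂ ξ ξ = 1 := by simp [inner_self_eq_norm_sq_to_K, hξ1]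
  let H := (ℂ ∙ ξ)ᗮ
  let P := H.orthogonalProjectionOnto
  have hP : ∀ w : E, ((P w : H) : E) = w - inner ℂ ξ w • ξ := by
    intro w
    rw [← Submodule.starProjection_apply, Submodule.starProjection_orthogonal_val,
      Submodule.starProjection_unit_singleton ℂ hξ1]
  have hH : ∀ h : H, inner ℂ ξ (h : E) = 0 := fun h =>
    Submodule.mem_orthogonal_singleton_iff_inner_right.mp h.2
  let T : H →ₗ[ℂ] H := P.toLinearMap ∘ₗ X ∘ₗ H.subtype
  have hTapp : ∀ h : H, T h = P (X h) := fun h => rfl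
  have hinner : ∀ (h : H) (w : E), inner ℂ (h : E) ((P w : H) : E) = inner ℂ (h : E) w := by
    intro h w
    rw [hP, inner_sub_right, inner_smul_right, ← inner_conj_symm (h : E) ξ, hH]
    simp
  have hT : T.IsSymmetric := by
    intro h k
    rw [Submodule.coe_inner, Submodule.coe_inner, hTapp, hTapp, hinner, ← hX,
      ← inner_conj_symm, hinner, inner_conj_symm]
  obtain ⟨n, c, b, hc, -, h⟩ := exists_inner_resolvent_eq_sum hT (P (X ξ))
  obtain ⟨a, ha⟩ : ∃ a : ℝ, (a : ℂ) = inner ℂ ξ (X ξ) := by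
    refine ⟨(inner ℂ ξ (X ξ)).re, ?_⟩
    rw [← Complex.conj_eq_iff_re, inner_conj_symm, hX]
  refine ⟨n, c, b, a, hc, fun z hz y hy hg0 => ?_⟩
  set g := inner ℂ ξ y with hg
  have hy' : y = g • ξ + (P y : E) := by rw [hP]; abel
  have hXy : X y = g • X ξ + X (P y : E) := by
    rw [← map_smul, ← map_add, ← hy']
  have h1 : z * g - (g * a + inner ℂ (X ξ) (P y : E)) = 1 := by
    have := congrArg (inner ℂ ξ) hy
    rw [inner_sub_right, inner_smul_right, hξ, hXy, inner_add_right, inner_smul_right, ← ha,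
      ← hX] at this
    exact this
  have h2 : z • P y - T (P y) = g • P (X ξ) := by
    have h3 := congrArg P hy
    have h4 : P ξ = 0 := by
      apply Subtype.ext
      rw [hP, hξ]; simp
    rw [h4, hXy, map_sub, map_smul, map_add, map_smul] at h3
    rw [hTapp, ← sub_eq_zero, ← h3]
    abel
  have h5 := h z hz (g⁻¹ • P y) (by
    rw [map_smul, smul_comm, ← smul_sub, h2, smul_smul, inv_mul_cancel₀ hg0, one_smul])
  rw [inner_smul_right, Submodule.coe_inner] at h5
  have h6 : inner ℂ ((P (X ξ) : H) : E) (P y : E) = inner ℂ (X ξ) (P y : E) := by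
    rw [← inner_conj_symm, hinner, inner_conj_symm]
  rw [h6] at h5
  rw [discreteG, ← h5]
  field_simp
  linear_combination -h1

/-- The reciprocal of the Cauchy transform of a finitely supported probability measure has the
form `z - a - ∑ cᵢ / (z - bᵢ)`. -/
lemma exists_inv_discreteG_eq {ι : Type*} [Fintype ι] {p : ι → ℝ} (hp : ∀ i, 0 ≤ p i)
    (hp1 : ∑ i, p i = 1) (x : ι → ℝ) :
    ∃ (n : ℕ) (c b : Fin n → ℝ) (a : ℝ), (∀ i, 0 ≤ c i) ∧
      ∀ z : ℂ, 0 < z.im → discreteG p x z ≠ 0 →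
        (discreteG p x z)⁻¹ = z - a - discreteG c b z := by
  classical
  have hX : (Matrix.diagonal fun i => (x i : ℂ)).IsHermitian := by
    refine Matrix.IsHermitian.ext fun i j => ?_
    by_cases h : i = j
    · subst h; simp
    · simp [h, Ne.symm h]
  let ξ : EuclideanSpace ℂ ι := WithLp.toLp 2 fun i => ((√(p i) : ℝ) : ℂ)
  have hξ : ‖ξ‖ = 1 := by
    rw [EuclideanSpace.norm_eq, Real.sqrt_eq_one, ← hp1]
    refine Finset.sum_congr rfl fun i _ => ?_
    change ‖((√(p i) : ℝ) : ℂ)‖ ^ 2 = _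
    rw [Complex.norm_real, Real.norm_eq_abs, sq_abs, Real.sq_sqrt (hp i)]
  obtain ⟨n, c, b, a, hc, h⟩ := exists_inv_inner_resolvent_eq
    (Matrix.isSymmetric_toEuclideanLin_iff.mpr hX) hξ
  refine ⟨n, c, b, a, hc, fun z hz hg => ?_⟩
  let y : EuclideanSpace ℂ ι :=
    WithLp.toLp 2 fun i => ((√(p i) : ℝ) : ℂ) * (z - (x i : ℂ))⁻¹
  have hy : z • y - Matrix.toEuclideanLin (Matrix.diagonal fun i => (x i : ℂ)) y = ξ := by
    ext i
    rw [PiLp.sub_apply, PiLp.smul_apply, toEuclideanLin_apply_eq_sum]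
    simp only [Matrix.diagonal_apply, ite_mul, zero_mul, Finset.sum_ite_eq, Finset.mem_univ,
      if_true, y, ξ, smul_eq_mul]
    have := sub_ofReal_ne_zero hz (x i)
    field_simp
  have hyg : inner ℂ ξ y = discreteG p x z := by
    rw [PiLp.inner_apply, discreteG]
    refine Finset.sum_congr rfl fun i _ => ?_
    simp only [ξ, y, RCLike.inner_apply, Complex.conj_ofReal]
    rw [mul_right_comm, ← Complex.ofReal_mul, Real.mul_self_sqrt (hp i)]
  have := h z hz y hy
  rw [hyg] at this
  exact this hg

open Filter Topology

lemma norm_inv_sub_ofReal_le {z : ℂ} (hz : 0 < z.im) (x : ℝ) : ‖(z - (x : ℂ))⁻¹‖ ≤ z.im⁻¹ := by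
  rw [norm_inv]
  refine inv_anti₀ hz ?_
  have := Complex.abs_im_le_norm (z - (x : ℂ))
  simp only [Complex.sub_im, Complex.ofReal_im, sub_zero] at this
  exact (le_abs_self _).trans this

lemma continuous_inv_sub_ofReal {z : ℂ} (hz : 0 < z.im) :
    Continuous fun x : ℝ => (z - (x : ℂ))⁻¹ :=
  (continuous_const.sub Complex.continuous_ofReal).inv₀ (sub_ofReal_ne_zero hz)

lemma integrable_inv_sub_ofReal (μ : Measure ℝ) [IsFiniteMeasure μ] {z : ℂ} (hz : 0 < z.im) :
    Integrable (fun x : ℝ => (z - (x : ℂ))⁻¹) μ :=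
  Integrable.mono' (integrable_const z.im⁻¹) (continuous_inv_sub_ofReal hz).aestronglyMeasurable
    (ae_of_all _ (norm_inv_sub_ofReal_le hz))

/-- Joint continuity of the Cauchy transform in the point and in an approximation of the
identity function. -/
lemma tendsto_integral_inv_sub (μ : Measure ℝ) [IsFiniteMeasure μ] {κ : Type*} {l : Filter κ}
    [l.IsCountablyGenerated] {w : κ → ℂ} {w₀ : ℂ} (hw₀ : 0 < w₀.im) (hw : Tendsto w l (𝓝 w₀))
    {s : κ → ℝ → ℝ} (hs : ∀ k, Measurable (s k))
    (hsx : ∀ x, Tendsto (fun k => s k x) l (𝓝 x)) :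
    Tendsto (fun k => ∫ x, (w k - (s k x : ℂ))⁻¹ ∂μ) l (𝓝 (cauchyG μ w₀)) := by
  have him : ∀ᶠ k in l, w₀.im / 2 < (w k).im :=
    ((Complex.continuous_im.tendsto w₀).comp hw).eventually (lt_mem_nhds (half_lt_self hw₀))
  refine tendsto_integral_filter_of_dominated_convergence (fun _ => (w₀.im / 2)⁻¹) ?_ ?_
    (integrable_const _) ?_
  · refine Eventually.of_forall fun k => ?_
    exact ((measurable_const.sub (Complex.measurable_ofReal.comp (hs k))).inv).aestronglyMeasurable
  · filter_upwards [him] with k hk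
    refine ae_of_all _ fun x => ?_
    exact (norm_inv_sub_ofReal_le ((half_pos hw₀).trans hk) _).trans
      (inv_anti₀ (half_pos hw₀) hk.le)
  · refine ae_of_all _ fun x => ?_
    exact (hw.sub ((Complex.continuous_ofReal.tendsto x).comp (hsx x))).inv₀
      (sub_ofReal_ne_zero hw₀ x)

lemma cauchyG_im_neg (μ : Measure ℝ) [IsProbabilityMeasure μ] {z : ℂ} (hz : 0 < z.im) :
    (cauchyG μ z).im < 0 := by
  have hint := integrable_inv_sub_ofReal μ hz
  have h1 : (cauchyG μ z).im = ∫ x : ℝ, ((z - (x : ℂ))⁻¹).im ∂μ := (integral_im hint).symm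
  have h2 : 0 < ∫ x : ℝ, -((z - (x : ℂ))⁻¹).im ∂μ := by
    have hpos : ∀ x : ℝ, 0 < -((z - (x : ℂ))⁻¹).im := fun x => by
      rw [Complex.inv_im, neg_div, neg_neg]
      refine div_pos (by simpa using hz) (Complex.normSq_pos.mpr (sub_ofReal_ne_zero hz x))
    rw [integral_pos_iff_support_of_nonneg (fun x => (hpos x).le) hint.im.neg]
    have : Function.support (fun x : ℝ => -((z - (x : ℂ))⁻¹).im) = Set.univ :=
      Set.eq_univ_of_forall fun x => (hpos x).ne'
    rw [this]; simp
  rw [integral_neg] at h2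
  linarith

lemma cauchyG_ne_zero (μ : Measure ℝ) [IsProbabilityMeasure μ] {z : ℂ} (hz : 0 < z.im) :
    cauchyG μ z ≠ 0 := fun h => by
  have := cauchyG_im_neg μ hz
  simp [h] at this

lemma inv_im_pos_of_im_neg {g : ℂ} (hg : g.im < 0) : 0 < (g⁻¹).im := by
  rw [Complex.inv_im]
  exact div_pos (by linarith) (Complex.normSq_pos.mpr fun h => by simp [h] at hg)

lemma Ftr_im_pos (μ : Measure ℝ) [IsProbabilityMeasure μ] {z : ℂ} (hz : 0 < z.im) :
    0 < (Ftr μ z).im := inv_im_pos_of_im_neg (cauchyG_im_neg μ hz)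

lemma tendsto_Ftr (μ : Measure ℝ) [IsProbabilityMeasure μ] {κ : Type*} {l : Filter κ}
    [l.IsCountablyGenerated] {w : κ → ℂ} {w₀ : ℂ} (hw₀ : 0 < w₀.im) (hw : Tendsto w l (𝓝 w₀)) :
    Tendsto (fun k => Ftr μ (w k)) l (𝓝 (Ftr μ w₀)) :=
  (tendsto_integral_inv_sub μ hw₀ hw (s := fun _ x => x) (fun _ => measurable_id)
    fun _ => tendsto_const_nhds).inv₀ (cauchyG_ne_zero μ hw₀)

/-- The filter of nontangential approach to infinity inside the cone `|Re z| ≤ Im z`. -/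
def coneAtTop : Filter ℂ := comap Complex.im atTop ⊓ 𝓟 {z | |z.re| ≤ z.im}

instance : coneAtTop.IsCountablyGenerated := by
  unfold coneAtTop; infer_instance

lemma eventually_coneAtTop {p : ℂ → Prop} :
    (∀ᶠ z in coneAtTop, p z) ↔ ∃ R : ℝ, 0 < R ∧ ∀ z : ℂ, |z.re| ≤ z.im → R ≤ z.im → p z := by
  rw [coneAtTop, eventually_inf_principal, eventually_comap,
    (atTop_basis' (1 : ℝ)).eventually_iff]
  constructor
  · rintro ⟨R, hR, h⟩
    exact ⟨R, one_pos.trans_le hR, fun z hz hRz => h hRz z rfl hz⟩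
  · rintro ⟨R, hR, h⟩
    refine ⟨max R 1, le_max_right _ _, fun b hb a hab ha => h a ha ?_⟩
    rw [hab]; exact (le_max_left _ _).trans hb

lemma norm_le_two_mul_im {z : ℂ} (hz : |z.re| ≤ z.im) : ‖z‖ ≤ 2 * z.im := by
  have h := Complex.norm_le_abs_re_add_abs_im z
  rw [abs_of_nonneg ((abs_nonneg _).trans hz)] at h
  linarith

lemma norm_mul_inv_sub_le {z : ℂ} (hz : |z.re| ≤ z.im) (hz0 : 0 < z.im) (x : ℝ) :
    ‖z * (z - (x : ℂ))⁻¹‖ ≤ 2 := by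
  rw [norm_mul]
  calc ‖z‖ * ‖(z - (x : ℂ))⁻¹‖ ≤ (2 * z.im) * z.im⁻¹ :=
        mul_le_mul (norm_le_two_mul_im hz) (norm_inv_sub_ofReal_le hz0 x) (norm_nonneg _)
          (by linarith)
    _ = 2 := by field_simp

lemma eventually_cone_mem : ∀ᶠ z in coneAtTop, |z.re| ≤ z.im ∧ 0 < z.im :=
  eventually_coneAtTop.mpr ⟨1, one_pos, fun _ h h1 => ⟨h, one_pos.trans_le h1⟩⟩

lemma tendsto_norm_coneAtTop : Tendsto (fun z : ℂ => ‖z‖) coneAtTop atTop := by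
  refine tendsto_atTop_mono (fun z => (le_abs_self _).trans (Complex.abs_im_le_norm z)) ?_
  exact tendsto_comap.mono_left inf_le_left

lemma tendsto_mul_inv_sub (x : ℝ) :
    Tendsto (fun z : ℂ => z * (z - (x : ℂ))⁻¹) coneAtTop (𝓝 1) := by
  have h0 : Tendsto (fun z : ℂ => 1 - (x : ℂ) * z⁻¹) coneAtTop (𝓝 (1 - (x : ℂ) * 0)) := by
    refine tendsto_const_nhds.sub (tendsto_const_nhds.mul ?_)
    exact tendsto_inv₀_cobounded.comp (tendsto_norm_atTop_iff_cobounded.mp tendsto_norm_coneAtTop)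
  rw [mul_zero, sub_zero] at h0
  have h1 := h0.inv₀ one_ne_zero
  rw [inv_one] at h1
  refine h1.congr' ?_
  filter_upwards [eventually_cone_mem] with z hz
  have hz0 : z ≠ 0 := fun h => by simp [h] at hz
  have := sub_ofReal_ne_zero hz.2 x
  have h2 : 1 - (x : ℂ) * z⁻¹ = (z - x) * z⁻¹ := by field_simp
  rw [h2, mul_inv, inv_inv, mul_comm]

lemma tendsto_mul_cauchyG (μ : Measure ℝ) [IsProbabilityMeasure μ] :
    Tendsto (fun z => z * cauchyG μ z) coneAtTop (𝓝 1) := by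
  have h : Tendsto (fun z : ℂ => ∫ x : ℝ, z * (z - (x : ℂ))⁻¹ ∂μ) coneAtTop
      (𝓝 (∫ _, 1 ∂μ)) := by
    refine tendsto_integral_filter_of_dominated_convergence (fun _ => 2) ?_ ?_
      (integrable_const _) (ae_of_all _ tendsto_mul_inv_sub)
    · filter_upwards [eventually_cone_mem] with z hz
      exact (continuous_const.mul (continuous_inv_sub_ofReal hz.2)).aestronglyMeasurable
    · filter_upwards [eventually_cone_mem] with z hz
      exact ae_of_all _ (norm_mul_inv_sub_le hz.1 hz.2)
  simpa [cauchyG, integral_const_mul] using h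

lemma tendsto_mul_mul_integral (μ : Measure ℝ) [IsProbabilityMeasure μ] :
    Tendsto (fun q : ℂ × ℂ => q.1 * q.2 * ∫ x : ℝ, (q.1 - (x : ℂ))⁻¹ * (q.2 - (x : ℂ))⁻¹ ∂μ)
      (coneAtTop ×ˢ coneAtTop) (𝓝 1) := by
  have hev : ∀ᶠ q : ℂ × ℂ in coneAtTop ×ˢ coneAtTop,
      (|q.1.re| ≤ q.1.im ∧ 0 < q.1.im) ∧ (|q.2.re| ≤ q.2.im ∧ 0 < q.2.im) :=
    eventually_cone_mem.prod_mk eventually_cone_mem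
  have h : Tendsto (fun q : ℂ × ℂ =>
      ∫ x : ℝ, (q.1 * (q.1 - (x : ℂ))⁻¹) * (q.2 * (q.2 - (x : ℂ))⁻¹) ∂μ)
      (coneAtTop ×ˢ coneAtTop) (𝓝 (∫ _, 1 ∂μ)) := by
    refine tendsto_integral_filter_of_dominated_convergence (fun _ => 2 * 2) ?_ ?_
      (integrable_const _) (ae_of_all _ fun x => ?_)
    · filter_upwards [hev] with q hq
      exact ((continuous_const.mul (continuous_inv_sub_ofReal hq.1.2)).mul
        (continuous_const.mul (continuous_inv_sub_ofReal hq.2.2))).aestronglyMeasurable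
    · filter_upwards [hev] with q hq
      refine ae_of_all _ fun x => ?_
      rw [norm_mul]
      exact mul_le_mul (norm_mul_inv_sub_le hq.1.1 hq.1.2 x) (norm_mul_inv_sub_le hq.2.1 hq.2.2 x)
        (norm_nonneg _) zero_le_two
    · have := ((tendsto_mul_inv_sub x).comp tendsto_fst).mul
        ((tendsto_mul_inv_sub x).comp (tendsto_snd (f := coneAtTop) (g := coneAtTop)))
      simpa using this
  simp only [integral_const, probReal_univ, one_smul] at h
  refine h.congr fun q => ?_
  rw [← integral_const_mul]
  congr 1; ext x; ring

/-- `F_μ(z) = z + o(z)` nontangentially. -/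
lemma exists_norm_Ftr_sub_le (μ : Measure ℝ) [IsProbabilityMeasure μ] {η : ℝ} (hη : 0 < η) :
    ∃ R : ℝ, 0 < R ∧ ∀ z : ℂ, |z.re| ≤ z.im → R ≤ z.im → ‖Ftr μ z - z‖ ≤ η * ‖z‖ := by
  rw [← eventually_coneAtTop]
  have h := ((tendsto_mul_cauchyG μ).inv₀ one_ne_zero).sub_const 1
  rw [inv_one, sub_self] at h
  have h' := h.norm
  rw [norm_zero] at h'
  filter_upwards [h'.eventually (gt_mem_nhds hη), eventually_cone_mem] with z hz hz'
  have hz0 : z ≠ 0 := fun h => by simp [h] at hz'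
  have : Ftr μ z - z = ((z * cauchyG μ z)⁻¹ - 1) * z := by
    rw [Ftr, mul_inv]; field_simp
  rw [this, norm_mul]
  gcongr

lemma Ftr_sub_Ftr (μ : Measure ℝ) [IsProbabilityMeasure μ] {z w : ℂ} (hz : 0 < z.im)
    (hw : 0 < w.im) :
    Ftr μ z - Ftr μ w = (z - w) * ((z * w * ∫ x : ℝ, (z - (x : ℂ))⁻¹ * (w - (x : ℂ))⁻¹ ∂μ) *
      (z * cauchyG μ z)⁻¹ * (w * cauchyG μ w)⁻¹) := by
  have h : cauchyG μ w - cauchyG μ z =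
      (z - w) * ∫ x : ℝ, (z - (x : ℂ))⁻¹ * (w - (x : ℂ))⁻¹ ∂μ := by
    rw [cauchyG, cauchyG, ← integral_sub (integrable_inv_sub_ofReal μ hw)
      (integrable_inv_sub_ofReal μ hz), ← integral_const_mul]
    congr 1; ext x
    have := sub_ofReal_ne_zero hz x
    have := sub_ofReal_ne_zero hw x
    field_simp
    ring
  have hz0 : z ≠ 0 := fun h => by simp [h] at hz
  have hw0 : w ≠ 0 := fun h => by simp [h] at hw
  have hGz := cauchyG_ne_zero μ hz
  have hGw := cauchyG_ne_zero μ hw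
  rw [Ftr, Ftr, inv_sub_inv hGz hGw, h]
  field_simp

/-- `F_μ` is nearly nonexpansive near infinity in the cone. -/
lemma exists_norm_Ftr_sub_Ftr_le (μ : Measure ℝ) [IsProbabilityMeasure μ] {q : ℝ} (hq : 1 < q) :
    ∃ R : ℝ, 0 < R ∧ ∀ z w : ℂ, |z.re| ≤ z.im → R ≤ z.im → |w.re| ≤ w.im → R ≤ w.im →
      ‖Ftr μ z - Ftr μ w‖ ≤ q * ‖z - w‖ := by
  have h1 := (tendsto_mul_cauchyG μ).inv₀ one_ne_zero
  have h := (((tendsto_mul_mul_integral μ).mul (h1.comp tendsto_fst)).mul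
    (h1.comp (tendsto_snd (f := coneAtTop) (g := coneAtTop)))).norm
  simp only [inv_one, mul_one, norm_one] at h
  have h2 := h.eventually (gt_mem_nhds hq)
  obtain ⟨p, hp, r, hr, hpr⟩ := eventually_prod_iff.mp h2
  obtain ⟨R, hR, hRp⟩ := eventually_coneAtTop.mp (hp.and (hr))
  refine ⟨R, hR, fun z w hz hRz hw hRw => ?_⟩
  rw [Ftr_sub_Ftr μ (hR.trans_le hRz) (hR.trans_le hRw), norm_mul, mul_comm]
  have := hpr (hRp z hz hRz).1 (hRp w hw hRw).2
  exact mul_le_mul_of_nonneg_right this.le (norm_nonneg _)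

lemma mem_cone_of_norm_sub_le {z w : ℂ} (hz : |z.re| ≤ z.im / 2)
    (h : ‖w - z‖ ≤ 8⁻¹ * ‖z‖) : |w.re| ≤ w.im ∧ 2⁻¹ * z.im ≤ w.im := by
  have hz0 : 0 ≤ z.im := by linarith [abs_nonneg z.re]
  have h1 := norm_le_two_mul_im (z := z) (by linarith)
  have h2 := Complex.abs_re_le_norm (w - z)
  have h3 := Complex.abs_im_le_norm (w - z)
  rw [Complex.sub_re] at h2
  rw [Complex.sub_im] at h3
  rw [abs_le] at *
  constructor
  · constructor <;> linarith [h2.1, h2.2, h3.1, h3.2, hz.1, hz.2]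
  · linarith [h2.1, h2.2, h3.1, h3.2, hz.1, hz.2]

/-- `F_μ` maps some truncated cone into any prescribed truncated cone. -/
lemma exists_Ftr_mem_tcone (μ : Measure ℝ) [IsProbabilityMeasure μ] {α : ℝ} (hα : 0 < α)
    (M : ℝ) : ∃ β N : ℝ, 0 < β ∧ 0 < N ∧ ∀ z ∈ tcone β N, Ftr μ z ∈ tcone α M := by
  obtain ⟨R, hR, h⟩ := exists_norm_Ftr_sub_le μ (η := min 8⁻¹ (α / 16)) (by positivity)
  refine ⟨min 1 (α / 4), max R (2 * |M| + 1), by positivity, by positivity, fun z hz => ?_⟩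
  obtain ⟨hz1, hz2⟩ := hz
  have hz0 : 0 < z.im := (hR.trans_le (le_max_left _ _)).trans hz2
  have hre1 : |z.re| ≤ z.im := hz1.le.trans (by nlinarith [min_le_left 1 (α / 4)])
  have hre2 : |z.re| ≤ α / 4 * z.im :=
    hz1.le.trans (by nlinarith [min_le_right 1 (α / 4)])
  have h0 := h z hre1 ((le_max_left _ _).trans hz2.le)
  have hn := norm_le_two_mul_im hre1
  have h4 : ‖Ftr μ z - z‖ ≤ 8⁻¹ * (2 * z.im) := h0.trans (by gcongr; exact min_le_left _ _)
  have h5 : ‖Ftr μ z - z‖ ≤ α / 16 * (2 * z.im) := h0.trans (by gcongr; exact min_le_right _ _)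
  have h2 := Complex.abs_re_le_norm (Ftr μ z - z)
  have h3 := Complex.abs_im_le_norm (Ftr μ z - z)
  rw [Complex.sub_re] at h2
  rw [Complex.sub_im] at h3
  have hM : 2 * |M| + 1 < z.im := (le_max_right _ _).trans_lt hz2
  have hMM := le_abs_self M
  have hαz : 0 < α * z.im := by positivity
  have him : 3 / 4 * z.im ≤ (Ftr μ z).im := by linarith [(abs_le.mp h3).1]
  refine ⟨?_, by linarith⟩
  have : |(Ftr μ z).re| ≤ |(Ftr μ z).re - z.re| + |z.re| := by
    simpa using abs_add_le ((Ftr μ z).re - z.re) z.re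
  nlinarith

lemma re_mul_inv_sub (y x : ℝ) :
    (((y : ℂ) * I) * ((y : ℂ) * I - (x : ℂ))⁻¹).re = y ^ 2 / (x ^ 2 + y ^ 2) := by
  simp only [Complex.mul_re, Complex.inv_re, Complex.inv_im, Complex.normSq_apply]
  simp
  ring

/-- The decay of the Cauchy transform along the imaginary axis controls the tails. -/
lemma measure_lt_norm_le (μ : Measure ℝ) [IsProbabilityMeasure μ] {y : ℝ} (hy : 0 < y) :
    μ {x | y < ‖x‖} ≤
      ENNReal.ofReal (2 * (1 - (((y : ℂ) * I) * cauchyG μ ((y : ℂ) * I)).re)) := by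
  have hyI : 0 < ((y : ℂ) * I).im := by simpa using hy
  have hint := (integrable_inv_sub_ofReal μ hyI).const_mul ((y : ℂ) * I)
  have h1 : (((y : ℂ) * I) * cauchyG μ ((y : ℂ) * I)).re
      = ∫ x : ℝ, y ^ 2 / (x ^ 2 + y ^ 2) ∂μ := by
    rw [cauchyG, ← integral_const_mul]
    refine (integral_re hint).symm.trans ?_
    congr 1; ext x
    exact re_mul_inv_sub y x
  have hint' : Integrable (fun x : ℝ => y ^ 2 / (x ^ 2 + y ^ 2)) μ :=
    hint.re.congr (ae_of_all _ fun x => re_mul_inv_sub y x)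
  have h2 : 1 - (((y : ℂ) * I) * cauchyG μ ((y : ℂ) * I)).re
      = ∫ x : ℝ, (1 - y ^ 2 / (x ^ 2 + y ^ 2)) ∂μ := by
    rw [integral_sub (integrable_const _) hint', h1]; simp
  have h3 := mul_meas_ge_le_integral_of_nonneg (μ := μ)
    (f := fun x : ℝ => 1 - y ^ 2 / (x ^ 2 + y ^ 2)) (ae_of_all _ fun x => by
      have : y ^ 2 / (x ^ 2 + y ^ 2) ≤ 1 := div_le_one_of_le₀ (by nlinarith) (by positivity)
      simpa using this) ((integrable_const _).sub hint') (1 / 2)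
  rw [← h2] at h3
  rw [← ofReal_measureReal]
  refine ENNReal.ofReal_le_ofReal ?_
  have h4 : μ.real {x | y < ‖x‖} ≤ μ.real {x | 1 / 2 ≤ 1 - y ^ 2 / (x ^ 2 + y ^ 2)} := by
    refine measureReal_mono fun x hx => ?_
    have hx' : y ^ 2 < x ^ 2 := by
      rw [← sq_abs x]
      have : y < |x| := hx
      gcongr
    change 1 / 2 ≤ 1 - y ^ 2 / (x ^ 2 + y ^ 2)
    have : y ^ 2 / (x ^ 2 + y ^ 2) ≤ 1 / 2 := by
      rw [div_le_div_iff₀ (by positivity) two_pos]; linarith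
    linarith
  linarith

/-- A compactness principle: if the Cauchy transforms converge far up the imaginary axis to a
function with the decay of the Cauchy transform of a probability measure, then some subsequence of
the measures converges. -/
lemma exists_subseq_tendsto_cauchyG {μ : ℕ → Measure ℝ} (hμ : ∀ n, IsProbabilityMeasure (μ n))
    {g : ℂ → ℂ} {M : ℝ}
    (hg : ∀ y : ℝ, M < y → Tendsto (fun n => cauchyG (μ n) (y * I)) atTop (𝓝 (g (y * I))))
    (hlim : Tendsto (fun y : ℝ => (y * I) * g (y * I)) atTop (𝓝 1)) :
    ∃ ν : Measure ℝ, IsProbabilityMeasure ν ∧ ∃ φ : ℕ → ℕ, StrictMono φ ∧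
      ∀ z : ℂ, 0 < z.im → Tendsto (fun n => cauchyG (μ (φ n)) z) atTop (𝓝 (cauchyG ν z)) := by
  have htight : IsTightMeasureSet (Set.range μ) := by
    refine isTightMeasureSet_range_of_tendsto_limsup_measure_norm_gt ?_
    have h1 : Tendsto (fun y : ℝ => ENNReal.ofReal (2 * (1 - ((y * I) * g (y * I)).re)))
        atTop (𝓝 0) := by
      have h2 := (((Complex.continuous_re.tendsto _).comp hlim).const_sub 1).const_mul 2
      have h3 := ENNReal.tendsto_ofReal h2
      simpa using h3
    refine tendsto_of_tendsto_of_tendsto_of_le_of_le' tendsto_const_nhds h1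
      (Eventually.of_forall fun _ => zero_le) ?_
    filter_upwards [eventually_gt_atTop M, eventually_gt_atTop 0] with y hM hy
    have h4 : Tendsto (fun n => ENNReal.ofReal
        (2 * (1 - (((y : ℂ) * I) * cauchyG (μ n) ((y : ℂ) * I)).re))) atTop
        (𝓝 (ENNReal.ofReal (2 * (1 - ((y * I) * g (y * I)).re)))) :=
      ENNReal.tendsto_ofReal ((((Complex.continuous_re.tendsto _).comp
        ((hg y hM).const_mul ((y : ℂ) * I))).const_sub 1).const_mul 2)
    rw [← h4.limsup_eq]
    exact limsup_le_limsup (Eventually.of_forall fun n => measure_lt_norm_le (μ n) hy)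
  let P : ℕ → ProbabilityMeasure ℝ := fun n => ⟨μ n, hμ n⟩
  have hcomp : IsCompact (closure (Set.range P)) := by
    refine isCompact_closure_of_isTightMeasureSet (htight.subset ?_)
    rintro _ ⟨_, ⟨n, rfl⟩, rfl⟩
    exact ⟨n, rfl⟩
  obtain ⟨ν, -, φ, hφ, hν⟩ := hcomp.tendsto_subseq
    (fun n => subset_closure (Set.mem_range_self n))
  refine ⟨ν, inferInstance, φ, hφ, fun z hz => ?_⟩
  rw [ProbabilityMeasure.tendsto_iff_forall_integral_rclike_tendsto ℂ] at hν
  exact hν (BoundedContinuousFunction.ofNormedAddCommGroup (fun x : ℝ => (z - (x : ℂ))⁻¹)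
    (continuous_inv_sub_ofReal hz) _ (norm_inv_sub_ofReal_le hz))

/-- Cauchy transforms of finitely supported measures, as functions on the upper half-plane. -/
def IsDiscreteG (N : ℂ → ℂ) : Prop :=
  ∃ (ι : Type) (_ : Fintype ι) (c b : ι → ℝ), (∀ i, 0 ≤ c i) ∧
    ∀ z : ℂ, 0 < z.im → N z = discreteG c b z

namespace IsDiscreteG

lemma zero : IsDiscreteG fun _ => 0 :=
  ⟨Fin 0, inferInstance, 0, 0, fun _ => le_rfl, fun z _ => by simp [discreteG]⟩

lemma add {N₁ N₂ : ℂ → ℂ} (h₁ : IsDiscreteG N₁) (h₂ : IsDiscreteG N₂) :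
    IsDiscreteG fun z => N₁ z + N₂ z := by
  obtain ⟨ι, _, c, b, hc, h⟩ := h₁
  obtain ⟨κ, _, d, e, hd, h'⟩ := h₂
  refine ⟨ι ⊕ κ, inferInstance, Sum.elim c d, Sum.elim b e, ?_, fun z hz => ?_⟩
  · rintro (i | i)
    exacts [hc i, hd i]
  · simp [h z hz, h' z hz, discreteG]

lemma const_mul {N : ℂ → ℂ} (h : IsDiscreteG N) {r : ℝ} (hr : 0 ≤ r) :
    IsDiscreteG fun z => r * N z := by
  obtain ⟨ι, _, c, b, hc, h⟩ := h
  refine ⟨ι, inferInstance, fun i => r * c i, b, fun i => mul_nonneg hr (hc i), fun z hz => ?_⟩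
  simp [h z hz, discreteG, Finset.mul_sum, mul_assoc]

lemma sum {κ : Type*} (s : Finset κ) {N : κ → ℂ → ℂ} (h : ∀ k, IsDiscreteG (N k)) :
    IsDiscreteG fun z => ∑ k ∈ s, N k z := by
  classical
  induction s using Finset.induction_on with
  | empty => simpa using zero
  | insert k s hk ih => simpa only [Finset.sum_insert hk] using (h k).add ih

lemma im_nonpos {N : ℂ → ℂ} (h : IsDiscreteG N) {z : ℂ} (hz : 0 < z.im) : (N z).im ≤ 0 := by
  obtain ⟨ι, _, c, b, hc, h⟩ := h
  rw [h z hz]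
  exact discreteG_im_nonpos hc b hz

end IsDiscreteG

/-- Reciprocal Cauchy transforms of finitely supported probability measures, as functions on the
upper half-plane. -/
def IsDiscreteF (f : ℂ → ℂ) : Prop :=
  ∃ (a : ℝ) (N : ℂ → ℂ), IsDiscreteG N ∧ ∀ z : ℂ, 0 < z.im → f z = z - a - N z

namespace IsDiscreteF

lemma id : IsDiscreteF fun z => z := ⟨0, _, .zero, fun z _ => by simp⟩

lemma im_pos {f : ℂ → ℂ} (hf : IsDiscreteF f) {z : ℂ} (hz : 0 < z.im) : 0 < (f z).im := by
  obtain ⟨a, N, hN, h⟩ := hf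
  have := hN.im_nonpos hz
  rw [h z hz]
  simp
  linarith

lemma sub_const {f : ℂ → ℂ} (hf : IsDiscreteF f) (r : ℝ) : IsDiscreteF fun z => f z - r := by
  obtain ⟨a, N, hN, h⟩ := hf
  exact ⟨a + r, N, hN, fun z hz => by beta_reduce; rw [h z hz]; push_cast; ring⟩

lemma exists_measure {f : ℂ → ℂ} (hf : IsDiscreteF f) :
    ∃ (n : ℕ) (p x : Fin n → ℝ), (∀ i, 0 ≤ p i) ∧ ∑ i, p i = 1 ∧
      ∀ z : ℂ, 0 < z.im → (f z)⁻¹ = discreteG p x z := by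
  obtain ⟨a, N, ⟨ι, _, c, b, hc, hN⟩, h⟩ := hf
  obtain ⟨n, p, x, hp, hp1, hpx⟩ := exists_inv_eq_discreteG hc b a
  exact ⟨n, p, x, hp, hp1, fun z hz => by rw [h z hz, hN z hz, hpx z hz]⟩

lemma isDiscreteG_inv {f : ℂ → ℂ} (hf : IsDiscreteF f) : IsDiscreteG fun z => (f z)⁻¹ := by
  obtain ⟨n, p, x, hp, -, h⟩ := hf.exists_measure
  exact ⟨Fin n, inferInstance, p, x, hp, h⟩

lemma comp {F f : ℂ → ℂ} (hF : IsDiscreteF F) (hf : IsDiscreteF f) :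
    IsDiscreteF fun z => F (f z) := by
  obtain ⟨a, N, ⟨ι, _, c, b, hc, hN⟩, h⟩ := hF
  have h1 : IsDiscreteG fun z => ∑ i, (c i : ℂ) * (f z - b i)⁻¹ :=
    .sum _ fun i => ((hf.sub_const (b i)).isDiscreteG_inv).const_mul (hc i)
  obtain ⟨a', N', hN', h'⟩ := hf
  refine ⟨a' + a, _, hN'.add h1, fun z hz => ?_⟩
  have him : 0 < (f z).im := im_pos ⟨a', N', hN', h'⟩ hz
  beta_reduce
  rw [h _ him, hN _ him, discreteG]
  push_cast
  linear_combination h' z hz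

lemma average {f : ℂ → ℂ} (hf : IsDiscreteF f) {t : ℝ} (ht : 0 ≤ t) :
    IsDiscreteF fun z => (z + t * f z) / (1 + t) := by
  obtain ⟨a, N, hN, h⟩ := hf
  refine ⟨t * a / (1 + t), _, hN.const_mul (r := t / (1 + t)) (by positivity), fun z hz => ?_⟩
  have h1 : (1 + t : ℂ) ≠ 0 := by
    have : (1 + t : ℝ) ≠ 0 := by positivity
    exact_mod_cast this
  beta_reduce
  rw [h z hz]
  push_cast
  field_simp
  ring

lemma exists_cauchyG_eq {f : ℂ → ℂ} (hf : IsDiscreteF f) :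
    ∃ μ : Measure ℝ, IsProbabilityMeasure μ ∧ ∀ z : ℂ, 0 < z.im → cauchyG μ z = (f z)⁻¹ := by
  obtain ⟨n, p, x, hp, hp1, h⟩ := hf.exists_measure
  refine ⟨∑ i, ENNReal.ofReal (p i) • Measure.dirac (x i), ⟨?_⟩, fun z hz => ?_⟩
  · simp [← ENNReal.ofReal_sum_of_nonneg fun i _ => hp i, hp1]
  · rw [h z hz, cauchyG, integral_finsetSum_measure, discreteG]
    · refine Finset.sum_congr rfl fun i _ => ?_
      rw [integral_smul_measure, integral_dirac, ENNReal.toReal_ofReal (hp i), Complex.real_smul]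
    · intro i _
      refine Integrable.smul_measure ?_ ENNReal.ofReal_ne_top
      exact integrable_inv_sub_ofReal _ hz

end IsDiscreteF

/-- Discretizing a probability measure by a simple function gives a rational reciprocal Cauchy
transform. -/
lemma isDiscreteF_simpleFunc (μ : Measure ℝ) [IsProbabilityMeasure μ] (s : SimpleFunc ℝ ℝ) :
    IsDiscreteF fun z => (∫ x, (z - (s x : ℂ))⁻¹ ∂μ)⁻¹ := by
  classical
  let p : s.range → ℝ := fun r => μ.real (s ⁻¹' {(r : ℝ)})
  have hmeas : ∀ r : s.range, MeasurableSet (s ⁻¹' {(r : ℝ)}) := fun r => s.measurableSet_fiber r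
  have hind : ∀ {E : Type} [AddCommMonoid E] (h : ℝ → E) (x : ℝ),
      h (s x) = ∑ r : s.range, (s ⁻¹' {(r : ℝ)}).indicator (fun _ => h r) x := by
    intro E _ h x
    rw [Finset.sum_eq_single ⟨s x, s.mem_range_self x⟩]
    · simp
    · intro r _ hr
      refine Set.indicator_of_notMem (fun hx => hr ?_) _
      exact Subtype.ext (Eq.symm hx)
    · simp
  have hsum : ∀ {E : Type} [NormedAddCommGroup E] [NormedSpace ℝ E] [CompleteSpace E]
      (h : ℝ → E), ∫ x, h (s x) ∂μ = ∑ r : s.range, p r • h r := by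
    intro E _ _ _ h
    rw [integral_congr_ae (ae_of_all _ fun x => hind h x), integral_finsetSum]
    · exact Finset.sum_congr rfl fun r _ => integral_indicator_const _ (hmeas r)
    · exact fun r _ => (integrable_const _).indicator (hmeas r)
  have hp1 : ∑ r, p r = 1 := by
    have := hsum (fun _ => (1 : ℝ))
    simpa using this.symm
  have hG : ∀ z : ℂ, ∫ x, (z - (s x : ℂ))⁻¹ ∂μ = discreteG p (fun r => (r : ℝ)) z := by
    intro z
    rw [hsum fun r => (z - (r : ℂ))⁻¹, discreteG]
    simp [Complex.real_smul]
  obtain ⟨n, c, b, a, hc, h⟩ :=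
    exists_inv_discreteG_eq (p := p) (fun _ => measureReal_nonneg) hp1 fun r => (r : ℝ)
  refine ⟨a, discreteG c b, ⟨Fin n, inferInstance, c, b, hc, fun _ _ => rfl⟩, fun z hz => ?_⟩
  beta_reduce
  rw [hG]
  refine h z hz ?_
  rw [← hG]
  have : IsProbabilityMeasure (μ.map s) := Measure.isProbabilityMeasure_map s.aemeasurable
  have h1 := cauchyG_ne_zero (μ.map s) hz
  rwa [cauchyG, integral_map s.aemeasurable
    (continuous_inv_sub_ofReal hz).aestronglyMeasurable] at h1

/-- The iterates of `w ↦ (z + t F(w)) / (1 + t)` started at `z`. Their limit `w` solves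
`t (w - F(w)) + w = z`. -/
def boolIter (t : ℝ) (F : ℂ → ℂ) : ℕ → ℂ → ℂ
  | 0, z => z
  | k + 1, z => (z + t * F (boolIter t F k z)) / (1 + t)

lemma one_add_ofReal_ne_zero {t : ℝ} (ht : 0 ≤ t) : (1 + t : ℂ) ≠ 0 := by
  have : (1 + t : ℝ) ≠ 0 := by positivity
  exact_mod_cast this

lemma norm_one_add_ofReal {t : ℝ} (ht : 0 ≤ t) : ‖(1 + t : ℂ)‖ = 1 + t := by
  rw [show (1 + t : ℂ) = ((1 + t : ℝ) : ℂ) by push_cast; rfl, Complex.norm_real,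
    Real.norm_of_nonneg (by positivity)]

lemma norm_average_sub {t : ℝ} (ht : 0 ≤ t) (z a b : ℂ) :
    ‖(z + t * a) / (1 + t) - (z + t * b) / (1 + t)‖ = t / (1 + t) * ‖a - b‖ := by
  rw [← sub_div, show z + t * a - (z + t * b) = t * (a - b) by ring, norm_div, norm_mul,
    norm_one_add_ofReal ht, Complex.norm_real, Real.norm_of_nonneg ht]
  ring

section boolIter

variable {t : ℝ} (σ : Measure ℝ) [IsProbabilityMeasure σ]

lemma boolIter_im_pos (ht : 0 ≤ t) (k : ℕ) {z : ℂ} (hz : 0 < z.im) :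
    0 < (boolIter t (Ftr σ) k z).im := by
  induction k with
  | zero => exact hz
  | succ k ih =>
    have h := Ftr_im_pos σ ih
    rw [boolIter, show (1 + t : ℂ) = ((1 + t : ℝ) : ℂ) by push_cast; rfl, Complex.div_ofReal_im]
    refine div_pos ?_ (by positivity)
    simpa using add_pos_of_pos_of_nonneg hz (mul_nonneg ht h.le)

lemma IsDiscreteF.boolIter (ht : 0 ≤ t) {F : ℂ → ℂ} (hF : IsDiscreteF F) (k : ℕ) :
    IsDiscreteF (boolIter t F k) := by
  induction k with
  | zero => exact .id
  | succ k ih => exact (hF.comp ih).average ht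

lemma exists_norm_boolIter_sub_le (ht : 0 ≤ t) {δ : ℝ} (hδ : 0 < δ) (hδ' : δ ≤ 8⁻¹) :
    ∃ R : ℝ, 0 < R ∧ ∀ z : ℂ, |z.re| ≤ z.im / 2 → R ≤ z.im → ∀ k,
      ‖boolIter t (Ftr σ) k z - z‖ ≤ δ * ‖z‖ := by
  obtain ⟨R, hR, h⟩ := exists_norm_Ftr_sub_le σ (η := δ / (2 * (1 + t))) (by positivity)
  refine ⟨2 * R, by positivity, fun z hz hRz k => ?_⟩
  induction k with
  | zero => simpa [boolIter] using mul_nonneg hδ.le (norm_nonneg z)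
  | succ k ih =>
    set w := boolIter t (Ftr σ) k z with hw
    obtain ⟨hc, him⟩ := mem_cone_of_norm_sub_le hz (ih.trans (by gcongr))
    have h1 := h w hc (by linarith)
    have h2 : ‖w‖ ≤ 2 * ‖z‖ := by
      have := norm_le_norm_add_norm_sub' w z
      nlinarith [norm_nonneg z]
    have h3 : ‖Ftr σ w - z‖ ≤ δ / (2 * (1 + t)) * (2 * ‖z‖) + δ * ‖z‖ := by
      calc ‖Ftr σ w - z‖ = ‖(Ftr σ w - w) + (w - z)‖ := by ring_nf
        _ ≤ ‖Ftr σ w - w‖ + ‖w - z‖ := norm_add_le _ _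
        _ ≤ _ := add_le_add (h1.trans (by gcongr)) ih
    have h4 : z = (z + t * z) / (1 + t) := by
      field_simp [one_add_ofReal_ne_zero ht]
    rw [_root_.boolIter, ← hw]
    nth_rw 2 [h4]
    rw [norm_average_sub ht]
    have ht1 : 0 < 1 + t := by positivity
    calc t / (1 + t) * ‖Ftr σ w - z‖
        ≤ t / (1 + t) * (δ / (2 * (1 + t)) * (2 * ‖z‖) + δ * ‖z‖) := by gcongr
      _ = (t * (2 + t) / (1 + t) ^ 2) * (δ * ‖z‖) := by field_simp; ring
      _ ≤ 1 * (δ * ‖z‖) := by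
          gcongr
          rw [div_le_one (by positivity)]
          nlinarith
      _ = δ * ‖z‖ := one_mul _

/-- A map asymptotic to the identity inside a cone has a reciprocal with the decay of the Cauchy
transform of a probability measure. -/
lemma tendsto_mul_inv_of_norm_sub_le {W : ℂ → ℂ}
    (hW : ∀ δ : ℝ, 0 < δ → δ ≤ 8⁻¹ → ∃ R : ℝ, 0 < R ∧ ∀ z : ℂ, |z.re| ≤ z.im / 2 → R ≤ z.im →
      ‖W z - z‖ ≤ δ * ‖z‖) :
    Tendsto (fun y : ℝ => ((y : ℂ) * I) * (W (y * I))⁻¹) atTop (𝓝 1) := by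
  have h : Tendsto (fun y : ℝ => W (y * I) * ((y : ℂ) * I)⁻¹) atTop (𝓝 1) := by
    rw [Metric.tendsto_atTop]
    intro ε hε
    obtain ⟨R, hR, h⟩ := hW (min 8⁻¹ (ε / 2)) (by positivity) (min_le_left _ _)
    refine ⟨R, fun y hy => ?_⟩
    have hy0 : 0 < y := hR.trans_le hy
    have hyI : (y : ℂ) * I ≠ 0 := by simp [hy0.ne']
    have h1 := h (y * I) (by simpa using (half_pos hy0).le) (by simpa using hy)
    rw [dist_eq_norm, show W (y * I) * ((y : ℂ) * I)⁻¹ - 1 = (W (y * I) - y * I) / (y * I) by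
      rw [sub_div, div_self hyI, div_eq_mul_inv], norm_div, div_lt_iff₀ (norm_pos_iff.mpr hyI)]
    refine h1.trans_lt ?_
    gcongr
    exact (min_le_right _ _).trans_lt (half_lt_self hε)
  simpa [mul_comm] using h.inv₀ one_ne_zero

lemma exists_cauchyG_eq_inv_boolIter (ht : 0 ≤ t) (k : ℕ) :
    ∃ μ : Measure ℝ, IsProbabilityMeasure μ ∧
      ∀ z : ℂ, 0 < z.im → cauchyG μ z = (boolIter t (Ftr σ) k z)⁻¹ := by
  let s : ℕ → SimpleFunc ℝ ℝ := fun n =>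
    SimpleFunc.approxOn id measurable_id Set.univ 0 (Set.mem_univ _) n
  have hs : ∀ x, Tendsto (fun n => s n x) atTop (𝓝 x) := fun x =>
    SimpleFunc.tendsto_approxOn measurable_id (Set.mem_univ _) (by simp)
  let F : ℕ → ℂ → ℂ := fun n z => (∫ x, (z - (s n x : ℂ))⁻¹ ∂σ)⁻¹
  have hF : ∀ z : ℂ, 0 < z.im →
      Tendsto (fun n => boolIter t (F n) k z) atTop (𝓝 (boolIter t (Ftr σ) k z)) := by
    intro z hz
    induction k with
    | zero => exact tendsto_const_nhds
    | succ k ih =>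
      have him := boolIter_im_pos σ ht k hz
      have h := (tendsto_integral_inv_sub σ him ih (fun n => (s n).measurable) hs).inv₀
        (cauchyG_ne_zero σ him)
      exact ((h.const_mul (t : ℂ)).const_add z).div_const _
  choose μ hμ hμF using fun n =>
    ((isDiscreteF_simpleFunc σ (s n)).boolIter ht k).exists_cauchyG_eq
  have hlim : ∀ z : ℂ, 0 < z.im →
      Tendsto (fun n => cauchyG (μ n) z) atTop (𝓝 (boolIter t (Ftr σ) k z)⁻¹) := by
    intro z hz
    refine ((hF z hz).inv₀ fun h => ?_).congr fun n => (hμF n z hz).symm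
    have := boolIter_im_pos σ ht k hz
    simp [h] at this
  obtain ⟨ν, hν, φ, hφ, hνφ⟩ := exists_subseq_tendsto_cauchyG hμ
    (g := fun z => (boolIter t (Ftr σ) k z)⁻¹) (M := 0) (fun y hy => hlim _ (by simpa using hy))
    (tendsto_mul_inv_of_norm_sub_le fun δ hδ hδ' => by
      obtain ⟨R, hR, h⟩ := exists_norm_boolIter_sub_le σ ht hδ hδ'
      exact ⟨R, hR, fun z hz hRz => h z hz hRz k⟩)
  exact ⟨ν, hν, fun z hz =>
    tendsto_nhds_unique (hνφ z hz) ((hlim z hz).comp hφ.tendsto_atTop)⟩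

lemma exists_tendsto_boolIter (ht : 0 ≤ t) :
    ∃ R : ℝ, 0 < R ∧ ∀ z : ℂ, |z.re| ≤ z.im / 2 → R ≤ z.im →
      ∃ w : ℂ, 0 < w.im ∧ Tendsto (fun k => boolIter t (Ftr σ) k z) atTop (𝓝 w) := by
  have ht1 : 0 < 1 + t := by positivity
  obtain ⟨R₁, hR₁, h₁⟩ := exists_norm_Ftr_sub_Ftr_le σ (q := 1 + 1 / (1 + t))
    (lt_add_of_pos_right _ (by positivity))
  obtain ⟨R₂, hR₂, h₂⟩ := exists_norm_boolIter_sub_le σ ht (δ := 8⁻¹) (by norm_num) le_rfl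
  refine ⟨max R₂ (2 * R₁), lt_max_of_lt_left hR₂, fun z hz hRz => ?_⟩
  have hcone := fun k => mem_cone_of_norm_sub_le hz (h₂ z hz ((le_max_left _ _).trans hRz) k)
  have him : 2 * R₁ ≤ z.im := (le_max_right _ _).trans hRz
  have hcontr : ∀ k, dist (boolIter t (Ftr σ) k z) (boolIter t (Ftr σ) (k + 1) z)
      ≤ dist z (boolIter t (Ftr σ) 1 z) * (t * (2 + t) / (1 + t) ^ 2) ^ k := by
    intro k
    induction k with
    | zero => simp [boolIter]
    | succ k ih =>
      have h3 := h₁ _ _ (hcone k).1 (by linarith [(hcone k).2]) (hcone (k + 1)).1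
        (by linarith [(hcone (k + 1)).2])
      rw [dist_eq_norm, boolIter, boolIter, norm_average_sub ht]
      rw [← dist_eq_norm (boolIter t (Ftr σ) k z)] at h3
      calc _ ≤ t / (1 + t) * ((1 + 1 / (1 + t)) *
            dist (boolIter t (Ftr σ) k z) (boolIter t (Ftr σ) (k + 1) z)) := by gcongr
        _ = t * (2 + t) / (1 + t) ^ 2 *
            dist (boolIter t (Ftr σ) k z) (boolIter t (Ftr σ) (k + 1) z) := by
          field_simp; ring
        _ ≤ t * (2 + t) / (1 + t) ^ 2 * (dist z (boolIter t (Ftr σ) 1 z) *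
            (t * (2 + t) / (1 + t) ^ 2) ^ k) := by gcongr
        _ = _ := by ring
  obtain ⟨w, hw⟩ := cauchySeq_tendsto_of_complete (cauchySeq_of_le_geometric _ _
    (by rw [div_lt_one (by positivity)]; nlinarith) hcontr)
  refine ⟨w, ?_, hw⟩
  have h4 := ge_of_tendsto' ((Complex.continuous_im.tendsto _).comp hw) fun k => (hcone k).2
  linarith

/-- The Voiculescu transform `z ↦ z - F_σ(z)` belongs to a freely infinitely divisible law. -/
lemma exists_isVT_mul_sub_Ftr (ht : 0 ≤ t) :
    ∃ ν : Measure ℝ, IsProbabilityMeasure ν ∧ IsVT ν (fun z => (t : ℂ) * (z - Ftr σ z)) := by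
  obtain ⟨R, hR, hconv⟩ := exists_tendsto_boolIter σ ht
  choose! W hWim hW using hconv
  choose μ hμ hμW using exists_cauchyG_eq_inv_boolIter σ ht
  have hlim : ∀ z : ℂ, |z.re| ≤ z.im / 2 → R ≤ z.im →
      Tendsto (fun k => cauchyG (μ k) z) atTop (𝓝 (W z)⁻¹) := by
    intro z hz hRz
    refine ((hW z hz hRz).inv₀ fun h => ?_).congr fun k => (hμW k z (hR.trans_le hRz)).symm
    have := hWim z hz hRz
    simp [h] at this
  obtain ⟨ν, hν, φ, hφ, hνφ⟩ := exists_subseq_tendsto_cauchyG hμ (g := fun z => (W z)⁻¹) (M := R)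
    (fun y hy => hlim _ (by simpa using (half_pos (hR.trans hy)).le) (by simpa using hy.le))
    (tendsto_mul_inv_of_norm_sub_le fun δ hδ hδ' => by
      obtain ⟨R', hR', h⟩ := exists_norm_boolIter_sub_le σ ht hδ hδ'
      refine ⟨max R R', lt_max_of_lt_left hR, fun z hz hRz => ?_⟩
      exact le_of_tendsto' (((hW z hz ((le_max_left _ _).trans hRz)).sub_const z).norm)
        fun k => h z hz ((le_max_right _ _).trans hRz) k)
  refine ⟨ν, hν, 1 / 2, R, by norm_num, hR, fun z hz => ?_⟩
  have hz1 : |z.re| ≤ z.im / 2 := by linarith [hz.1]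
  have hz2 : R ≤ z.im := hz.2.le
  have hF : Ftr ν z = W z := by
    rw [Ftr, tendsto_nhds_unique (hνφ z (hR.trans_le hz2))
      ((hlim z hz1 hz2).comp hφ.tendsto_atTop), inv_inv]
  have hfix : W z = (z + t * Ftr σ (W z)) / (1 + t) :=
    tendsto_nhds_unique ((tendsto_add_atTop_iff_nat 1).mpr (hW z hz1 hz2))
      ((((tendsto_Ftr σ (hWim z hz1 hz2) (hW z hz1 hz2)).const_mul (t : ℂ)).const_add z).div_const _)
  rw [eq_div_iff (one_add_ofReal_ne_zero ht)] at hfix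
  rw [hF]
  linear_combination hfix

end boolIter

lemma tcone_subset_tcone {α α' M M' : ℝ} (hα : α ≤ α') (hM : M ≤ M') (hM0 : 0 ≤ M) :
    tcone α M' ⊆ tcone α' M := fun z hz => by
  have h : M < z.im := hM.trans_lt hz.2
  exact ⟨hz.1.trans_le (by have := hM0.trans_lt h; gcongr), h⟩

/-- The relation `z = (w - F_{μ ⊳ ν'}(w)) + w` at `w = F_{μ ⊳ ν}(z)`, where `ν = μ ⊞ ν'`. -/
lemma isVT_subordination {ν' ν c sub sub' : Measure ℝ} [IsProbabilityMeasure sub]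
    [IsProbabilityMeasure sub'] {φμ φν' : ℂ → ℂ} (hφν' : IsVT ν' φν')
    (hν : IsVT ν (fun z => φμ z + φν' z)) (hc : IsVT c (fun z => 2 * φμ z + φν' z))
    (hsub : ∀ z ∈ UHP, cauchyG c z = cauchyG ν (Ftr sub z))
    (hsub' : ∀ z ∈ UHP, cauchyG ν z = cauchyG ν' (Ftr sub' z)) :
    IsVT sub (fun z => z - Ftr sub' z) := by
  obtain ⟨α₁, M₁, hα₁, hM₁, h₁⟩ := hφν'
  obtain ⟨α₂, M₂, hα₂, hM₂, h₂⟩ := hν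
  obtain ⟨α₃, M₃, hα₃, hM₃, h₃⟩ := hc
  obtain ⟨β₁, N₁, hβ₁, hN₁, k₁⟩ := exists_Ftr_mem_tcone sub' hα₁ M₁
  obtain ⟨β₂, N₂, hβ₂, hN₂, k₂⟩ :=
    exists_Ftr_mem_tcone sub (α := min α₂ β₁) (by positivity) (max M₂ N₁)
  refine ⟨min α₃ β₂, max M₃ N₂, by positivity, by positivity, fun z hz => ?_⟩
  have hz₃ := tcone_subset_tcone (min_le_left _ _) (le_max_left _ _) hM₃.le hz
  have hw := k₂ z (tcone_subset_tcone (min_le_right _ _) (le_max_right _ _) hN₂.le hz)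
  have hw₂ := tcone_subset_tcone (min_le_left _ _) (le_max_left _ _) hM₂.le hw
  have hv := k₁ _ (tcone_subset_tcone (min_le_right _ _) (le_max_right _ _) hN₁.le hw)
  have e₃ := h₃ z hz₃
  have e₂ := h₂ _ hw₂
  have e₁ := h₁ _ hv
  have f₁ : Ftr c z = Ftr ν (Ftr sub z) := congrArg (·⁻¹) (hsub z (hM₃.trans hz₃.2))
  have f₂ : Ftr ν (Ftr sub z) = Ftr ν' (Ftr sub' (Ftr sub z)) :=
    congrArg (·⁻¹) (hsub' _ (hM₂.trans hw₂.2))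
  rw [f₁, f₂] at e₃
  rw [f₂] at e₂
  linear_combination e₃ - 2 * e₂ + e₁

/-- If `ν = μ ⊞ ν′`, then the subordination distribution satisfies
`μ ⊳ ν = B[μ ⊳ ν′]`; in particular `μ ⊳ (μ ⊞ ν′)` is ⊞-infinitely divisible.
Here `c = μ ⊞ ν = μ^{⊞2} ⊞ ν′`, `sub = μ ⊳ ν`, `sub' = μ ⊳ ν′`, and `B[sub'] ` is
characterized by having Voiculescu transform `z ↦ z − F_{sub'}(z)`. -/
theorem stmt3
    (μ ν' : Measure ℝ) (hμ : IsProbabilityMeasure μ) (hν' : IsProbabilityMeasure ν')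
    (φμ φν' : ℂ → ℂ) (hφμ : IsVT μ φμ) (hφν' : IsVT ν' φν')
    (ν : Measure ℝ) (hνprob : IsProbabilityMeasure ν)
    (hν : IsVT ν (fun z => φμ z + φν' z))
    (c : Measure ℝ) (hcprob : IsProbabilityMeasure c)
    (hc : IsVT c (fun z => 2 * φμ z + φν' z))
    (sub : Measure ℝ) (hsubprob : IsProbabilityMeasure sub)
    (hsub : ∀ z ∈ UHP, cauchyG c z = cauchyG ν (Ftr sub z))
    (sub' : Measure ℝ) (hsub'prob : IsProbabilityMeasure sub')
    (hsub' : ∀ z ∈ UHP, cauchyG ν z = cauchyG ν' (Ftr sub' z)) :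
    IsVT sub (fun z => z - Ftr sub' z) ∧ IsFID sub := by
  refine ⟨isVT_subordination hφν' hν hc hsub hsub', fun z => z - Ftr sub' z,
    isVT_subordination hφν' hν hc hsub hsub', fun t ht => exists_isVT_mul_sub_Ftr sub' ht⟩
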